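/- Let C be a rank-metric code in F_q^{n×m} with n ≤ m. Then C is a dually qOAC if and only if maxrk(C) + maxrk(C^⊥) = n + 1. -/

import Mathlib

open Matrix

/-- The maximum rank of a rank-metric code (an `𝔽`-linear subspace of `n × m` matrices). -/
noncomputable def maxrk {𝔽 : Type*} [Field 𝔽] {n m : ℕ}
    (C : Submodule 𝔽 (Matrix (Fin n) (Fin m) 𝔽)) : ℕ :=
  sSup (Matrix.rank '' (C : Set (Matrix (Fin n) (Fin m) 𝔽)))

/-- The dual code with respect to the trace bilinear form `⟨M, N⟩ = Tr(M Nᵗ)`. -/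
def dualCode {𝔽 : Type*} [Field 𝔽] {n m : ℕ}
    (C : Submodule 𝔽 (Matrix (Fin n) (Fin m) 𝔽)) :
    Submodule 𝔽 (Matrix (Fin n) (Fin m) 𝔽) where
  carrier := {M | ∀ N ∈ C, Matrix.trace (M * Nᵀ) = 0}
  add_mem' := by
    intro a b ha hb N hN
    show Matrix.trace ((a + b) * Nᵀ) = 0
    rw [Matrix.add_mul, Matrix.trace_add, ha N hN, hb N hN, add_zero]
  zero_mem' := by
    intro N hN
    simp
  smul_mem' := by
    intro c a ha N hN
    show Matrix.trace ((c • a) * Nᵀ) = 0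
    rw [Matrix.smul_mul, Matrix.trace_smul, ha N hN, smul_zero]

/-- `C` is an optimal anticode if `dim C = m * maxrk C`. -/
def isOptAnticode {𝔽 : Type*} [Field 𝔽] {n m : ℕ}
    (C : Submodule 𝔽 (Matrix (Fin n) (Fin m) 𝔽)) : Prop :=
  Module.finrank 𝔽 C = m * maxrk C

/-- `C` is a quasi optimal anticode if `m ∤ dim C` and `maxrk C = ⌈dim C / m⌉`. -/
def isQOAC {𝔽 : Type*} [Field 𝔽] {n m : ℕ}
    (C : Submodule 𝔽 (Matrix (Fin n) (Fin m) 𝔽)) : Prop :=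
  ¬ (m ∣ Module.finrank 𝔽 C) ∧
    (maxrk C : ℤ) = ⌈(Module.finrank 𝔽 C : ℚ) / (m : ℚ)⌉

/-- `C` is a dually quasi optimal anticode if both `C` and `C^⊥` are qOACs. -/
def isDuallyQOAC {𝔽 : Type*} [Field 𝔽] {n m : ℕ}
    (C : Submodule 𝔽 (Matrix (Fin n) (Fin m) 𝔽)) : Prop :=
  isQOAC C ∧ isQOAC (dualCode C)

/-- The code of matrices vanishing at all positions `(i, j)` with `¬ P i j`. -/
def zeroOutside {𝔽 : Type*} [Field 𝔽] {n m : ℕ} (P : Fin n → Fin m → Prop) :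
    Submodule 𝔽 (Matrix (Fin n) (Fin m) 𝔽) where
  carrier := {M | ∀ i j, ¬ P i j → M i j = 0}
  add_mem' := by
    intro a b ha hb i j h
    simp [Matrix.add_apply, ha i j h, hb i j h]
  zero_mem' := by
    intro i j h
    simp
  smul_mem' := by
    intro c a ha i j h
    simp [Matrix.smul_apply, ha i j h]

/-- `Mat(V)`: the matrices all of whose columns lie in `V ⊆ 𝔽^n`. -/
def matCol {𝔽 : Type*} [Field 𝔽] {n m : ℕ} (V : Submodule 𝔽 (Fin n → 𝔽)) :
    Submodule 𝔽 (Matrix (Fin n) (Fin m) 𝔽) where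
  carrier := {M | ∀ j, (fun i => M i j) ∈ V}
  add_mem' := by
    intro a b ha hb j
    exact V.add_mem (ha j) (hb j)
  zero_mem' := by
    intro j
    exact V.zero_mem
  smul_mem' := by
    intro c a ha j
    exact V.smul_mem c (ha j)

/-- `Mat(U)ᵗ`: the matrices all of whose rows lie in `U ⊆ 𝔽^m`. -/
def matRow {𝔽 : Type*} [Field 𝔽] {n m : ℕ} (U : Submodule 𝔽 (Fin m → 𝔽)) :
    Submodule 𝔽 (Matrix (Fin n) (Fin m) 𝔽) where
  carrier := {M | ∀ i, M i ∈ U}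
  add_mem' := by
    intro a b ha hb i
    exact U.add_mem (ha i) (hb i)
  zero_mem' := by
    intro i
    exact U.zero_mem
  smul_mem' := by
    intro c a ha i
    exact U.smul_mem c (ha i)

/-- `⟨e_1, …, e_s⟩ ⊆ 𝔽^ℓ`: the span of the first `s` canonical basis vectors. -/
def spanFirst (𝔽 : Type*) [Field 𝔽] (ℓ s : ℕ) : Submodule 𝔽 (Fin ℓ → 𝔽) :=
  Submodule.span 𝔽 ((fun i : Fin ℓ => Pi.single i (1 : 𝔽)) '' {i : Fin ℓ | (i : ℕ) < s})

/-- Orthogonal complement with respect to the standard dot product on `𝔽^ℓ`. -/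
def perp {𝔽 : Type*} [Field 𝔽] {ℓ : ℕ} (W : Submodule 𝔽 (Fin ℓ → 𝔽)) :
    Submodule 𝔽 (Fin ℓ → 𝔽) where
  carrier := {v | ∀ w ∈ W, ∑ i, v i * w i = 0}
  add_mem' := by
    intro a b ha hb w hw
    simp [add_mul, Finset.sum_add_distrib, ha w hw, hb w hw]
  zero_mem' := by
    intro w hw
    simp
  smul_mem' := by
    intro c a ha w hw
    simp [mul_assoc, ← Finset.mul_sum, ha w hw]

/-- Equivalence of rank-metric codes: `C = {N A M : A ∈ D}` for invertible `N, M`, or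
(when `n = m`) `C = {N Aᵗ M : A ∈ D}` for invertible `N, M`. -/
def equivCode {𝔽 : Type*} [Field 𝔽] {n m : ℕ}
    (C D : Submodule 𝔽 (Matrix (Fin n) (Fin m) 𝔽)) : Prop :=
  (∃ (N : Matrix (Fin n) (Fin n) 𝔽) (M : Matrix (Fin m) (Fin m) 𝔽),
      IsUnit N ∧ IsUnit M ∧
      (C : Set (Matrix (Fin n) (Fin m) 𝔽)) = (fun A : Matrix (Fin n) (Fin m) 𝔽 => N * A * M) '' (D : Set (Matrix (Fin n) (Fin m) 𝔽))) ∨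
  (∃ (h : n = m) (N : Matrix (Fin n) (Fin n) 𝔽) (M : Matrix (Fin m) (Fin m) 𝔽),
      IsUnit N ∧ IsUnit M ∧
      (C : Set (Matrix (Fin n) (Fin m) 𝔽)) =
        (fun A : Matrix (Fin n) (Fin m) 𝔽 =>
          N * (Matrix.reindex (finCongr h.symm) (finCongr h) Aᵀ) * M) ''
          (D : Set (Matrix (Fin n) (Fin m) 𝔽)))

/-- The Gaussian `q`-binomial coefficient, as a rational number. -/
def gaussBinom (q a r : ℕ) : ℚ :=
  (∏ i ∈ Finset.range r, ((q : ℚ) ^ a - (q : ℚ) ^ i)) /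
    (∏ i ∈ Finset.range r, ((q : ℚ) ^ r - (q : ℚ) ^ i))

/-- `φ_q(a, b, r)`: the number of rank-`r` matrices in `𝔽_q^{a×b}`. -/
def phiq (q a b r : ℕ) : ℚ :=
  gaussBinom q a r * ∏ i ∈ Finset.range r, ((q : ℚ) ^ b - (q : ℚ) ^ i)


open Module

section MaxRank

variable {𝔽 : Type*} [Field 𝔽] {n m : ℕ}

lemma bddAbove_rank_image (C : Submodule 𝔽 (Matrix (Fin n) (Fin m) 𝔽)) :
    BddAbove (Matrix.rank '' (C : Set (Matrix (Fin n) (Fin m) 𝔽))) := by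
  refine ⟨n, ?_⟩
  rintro _ ⟨M, -, rfl⟩
  exact M.rank_le_height

lemma rank_le_maxrk {C : Submodule 𝔽 (Matrix (Fin n) (Fin m) 𝔽)}
    {M : Matrix (Fin n) (Fin m) 𝔽} (hM : M ∈ C) : M.rank ≤ maxrk C :=
  le_csSup (bddAbove_rank_image C) ⟨M, hM, rfl⟩

lemma maxrk_le {C : Submodule 𝔽 (Matrix (Fin n) (Fin m) 𝔽)} {r : ℕ}
    (h : ∀ M ∈ C, M.rank ≤ r) : maxrk C ≤ r := by
  refine csSup_le ⟨_, 0, C.zero_mem, rfl⟩ ?_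
  rintro _ ⟨M, hM, rfl⟩
  exact h M hM

lemma maxrk_le_height (C : Submodule 𝔽 (Matrix (Fin n) (Fin m) 𝔽)) : maxrk C ≤ n :=
  maxrk_le fun M _ => M.rank_le_height

end MaxRank

section Duality

variable {𝔽 : Type*} [Field 𝔽] {n m : ℕ}

lemma trace_mul_transpose_comm (M N : Matrix (Fin n) (Fin m) 𝔽) :
    trace (M * Nᵀ) = trace (N * Mᵀ) := by
  rw [← trace_transpose, transpose_mul, transpose_transpose]

/-- The trace bilinear form `⟨M, N⟩ = Tr(M Nᵗ)` on matrices. -/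
def traceBilin (𝔽 : Type*) [Field 𝔽] (n m : ℕ) :
    LinearMap.BilinForm 𝔽 (Matrix (Fin n) (Fin m) 𝔽) :=
  LinearMap.mk₂ 𝔽 (fun M N => trace (M * Nᵀ))
    (fun A B N => by rw [Matrix.add_mul, trace_add])
    (fun c A N => by rw [Matrix.smul_mul, trace_smul])
    (fun M A B => by rw [transpose_add, Matrix.mul_add, trace_add])
    (fun c M A => by rw [transpose_smul, Matrix.mul_smul, trace_smul])

lemma traceBilin_apply (M N : Matrix (Fin n) (Fin m) 𝔽) :
    traceBilin 𝔽 n m M N = trace (M * Nᵀ) := rfl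

lemma traceBilin_isRefl : (traceBilin 𝔽 n m).IsRefl := fun M N h => by
  rwa [traceBilin_apply, trace_mul_transpose_comm]

lemma eq_zero_of_trace_mul_transpose {M : Matrix (Fin n) (Fin m) 𝔽}
    (h : ∀ N : Matrix (Fin n) (Fin m) 𝔽, trace (M * Nᵀ) = 0) : M = 0 := by
  refine Matrix.ext_iff_trace_mul_right.2 fun X => ?_
  simpa using h Xᵀ

lemma traceBilin_nondegenerate : (traceBilin 𝔽 n m).Nondegenerate :=
  ⟨fun _ h => eq_zero_of_trace_mul_transpose h,
    fun _ h => eq_zero_of_trace_mul_transpose fun N => traceBilin_isRefl N _ (h N)⟩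

lemma dualCode_eq_orthogonal (C : Submodule 𝔽 (Matrix (Fin n) (Fin m) 𝔽)) :
    dualCode C = (traceBilin 𝔽 n m).orthogonal C := by
  ext M
  refine forall₂_congr fun N _ => ?_
  rw [trace_mul_transpose_comm]
  rfl

lemma finrank_add_finrank_dualCode (C : Submodule 𝔽 (Matrix (Fin n) (Fin m) 𝔽)) :
    finrank 𝔽 C + finrank 𝔽 (dualCode C) = m * n := by
  have h := LinearMap.BilinForm.finrank_orthogonal traceBilin_nondegenerate C
  have hle := Submodule.finrank_le C
  rw [finrank_matrix, Fintype.card_fin, Fintype.card_fin, finrank_self, mul_one] at h hle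
  rw [dualCode_eq_orthogonal, h, mul_comm m n]
  omega

lemma dualCode_dualCode (C : Submodule 𝔽 (Matrix (Fin n) (Fin m) 𝔽)) :
    dualCode (dualCode C) = C := by
  refine (Submodule.eq_of_le_of_finrank_eq (fun M hM N hN => ?_) ?_).symm
  · rw [trace_mul_transpose_comm]
    exact hN M hM
  · have h₁ := finrank_add_finrank_dualCode C
    have h₂ := finrank_add_finrank_dualCode (dualCode C)
    omega

/-- If two codes of complementary dimension intersect trivially, a matrix orthogonal to both
vanishes. -/
lemma eq_zero_of_mem_dualCode {C D : Submodule 𝔽 (Matrix (Fin n) (Fin m) 𝔽)}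
    (hdim : finrank 𝔽 C + finrank 𝔽 D = m * n) (hdisj : C ⊓ D = ⊥)
    {M : Matrix (Fin n) (Fin m) 𝔽} (hC : M ∈ dualCode C) (hD : M ∈ dualCode D) : M = 0 := by
  have hsup : C ⊔ D = ⊤ := by
    refine Submodule.eq_top_of_finrank_eq ?_
    have h := Submodule.finrank_sup_add_finrank_inf_eq C D
    rw [hdisj, finrank_bot, hdim] at h
    rw [finrank_matrix, Fintype.card_fin, Fintype.card_fin, finrank_self, mul_one, mul_comm n m]
    exact h
  refine eq_zero_of_trace_mul_transpose fun N => ?_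
  obtain ⟨A, hA, B, hB, rfl⟩ := Submodule.mem_sup.1 (hsup ▸ Submodule.mem_top : N ∈ C ⊔ D)
  rw [transpose_add, Matrix.mul_add, trace_add, hC A hA, hD B hB, add_zero]

/-- The dual of a maximum rank distance code is a maximum rank distance code. -/
lemma lt_rank_of_mem_dualCode {D : Submodule 𝔽 (Matrix (Fin n) (Fin m) 𝔽)} {k : ℕ} (hk : k ≤ n)
    (hdim : finrank 𝔽 D = m * k) (hD : ∀ N ∈ D, N ≠ 0 → n < N.rank + k)
    {M : Matrix (Fin n) (Fin m) 𝔽} (hM : M ∈ dualCode D) (hM0 : M ≠ 0) : k < M.rank := by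
  by_contra! hr
  have hker : n - k ≤ finrank 𝔽 (LinearMap.ker Mᵀ.mulVecLin) := by
    have h := LinearMap.finrank_range_add_finrank_ker Mᵀ.mulVecLin
    rw [finrank_fin_fun] at h
    have h' : finrank 𝔽 (LinearMap.range Mᵀ.mulVecLin) = M.rank := rank_transpose M
    omega
  obtain ⟨v, hv⟩ := exists_linearIndependent_of_le_finrank hker
  have hv' : LinearIndependent 𝔽 fun i => (v i : Fin n → 𝔽) :=
    hv.map' (Submodule.subtype _) (Submodule.ker_subtype _)
  let V : Matrix (Fin (n - k)) (Fin n) 𝔽 := Matrix.of fun i => (v i : Fin n → 𝔽)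
  have hVM : Mᵀ * Vᵀ = 0 := by
    ext j i
    exact congrFun (v i).2 j
  let φ : Matrix (Fin (n - k)) (Fin m) 𝔽 →ₗ[𝔽] Matrix (Fin n) (Fin m) 𝔽 :=
    { toFun := fun Y => Vᵀ * Y
      map_add' := fun A B => Matrix.mul_add _ _ _
      map_smul' := fun c A => Matrix.mul_smul _ _ _ }
  have hφ : Function.Injective φ := by
    have hinj : Function.Injective Vᵀ.mulVec := by
      rw [Matrix.mulVec_injective_iff]
      exact hv'
    intro A B hAB
    ext i j
    refine congrFun (@hinj (fun i => A i j) (fun i => B i j) ?_) i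
    ext l
    exact congrFun (congrFun hAB l) j
  have hrange : finrank 𝔽 (LinearMap.range φ) = m * (n - k) := by
    rw [LinearMap.finrank_range_of_inj hφ, finrank_matrix, Fintype.card_fin, Fintype.card_fin,
      finrank_self, mul_one, mul_comm]
  refine hM0 (eq_zero_of_mem_dualCode (C := D) (D := LinearMap.range φ) ?_ ?_ hM ?_)
  · rw [hdim, hrange, ← mul_add, Nat.add_sub_cancel' hk]
  · rw [Submodule.eq_bot_iff]
    rintro _ ⟨hN, Y, rfl⟩
    by_contra hN0
    have h₁ := hD _ hN hN0
    have h₂ : (φ Y).rank ≤ n - k := (rank_mul_le_right Vᵀ Y).trans Y.rank_le_height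
    omega
  · rintro _ ⟨Y, rfl⟩
    rw [trace_mul_transpose_comm]
    change trace (Vᵀ * Y * Mᵀ) = 0
    rw [Matrix.trace_mul_cycle, hVM, Matrix.zero_mul, trace_zero]

end Duality

section Gabidulin

variable (𝔽 L : Type*) [Field 𝔽] [Fintype 𝔽] [Field L] [Algebra 𝔽 L]

/-- The `𝔽`-linear endomorphism `x ↦ ∑ i, a i * x ^ (q ^ i)` of `L`, linearly in `a`. -/
noncomputable def linearizedPoly (k : ℕ) : (Fin k → L) →ₗ[𝔽] L →ₗ[𝔽] L :=
  ∑ i : Fin k, LinearMap.lcomp 𝔽 L (FiniteField.frobeniusAlgHom 𝔽 L ^ (i : ℕ)).toLinearMap ∘ₗ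
    LinearMap.mul 𝔽 L ∘ₗ LinearMap.proj i

variable {𝔽 L}

lemma linearizedPoly_apply {k : ℕ} (a : Fin k → L) (x : L) :
    linearizedPoly 𝔽 L k a x = ∑ i, a i * x ^ (Fintype.card 𝔽 ^ (i : ℕ)) := by
  simp [linearizedPoly, LinearMap.sum_apply, FiniteField.coe_frobeniusAlgHom, pow_iterate]

lemma finrank_ker_linearizedPoly_lt [FiniteDimensional 𝔽 L] {k : ℕ} {a : Fin k → L} (ha : a ≠ 0) :
    finrank 𝔽 (LinearMap.ker (linearizedPoly 𝔽 L k a)) < k := by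
  classical
  obtain ⟨i₀, hi₀⟩ := Function.ne_iff.1 ha
  have hq : 1 < Fintype.card 𝔽 := Fintype.one_lt_card
  have hinj := Nat.pow_right_injective hq
  let p : Polynomial L := ∑ i : Fin k, Polynomial.monomial (Fintype.card 𝔽 ^ (i : ℕ)) (a i)
  have hp0 : p ≠ 0 := by
    intro h
    apply hi₀
    have h' := congrArg (fun r => Polynomial.coeff r (Fintype.card 𝔽 ^ (i₀ : ℕ))) h
    simpa [p, Polynomial.finsetSum_coeff, Polynomial.coeff_monomial, hinj.eq_iff, Fin.val_inj]
      using h'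
  have hdeg : p.natDegree ≤ Fintype.card 𝔽 ^ (k - 1) := by
    refine Polynomial.natDegree_sum_le_of_forall_le _ _ fun i _ => ?_
    refine (Polynomial.natDegree_monomial_le _).trans ?_
    exact Nat.pow_le_pow_right hq.le (by omega)
  have : Finite L := Module.finite_of_finite 𝔽
  have : Fintype (LinearMap.ker (linearizedPoly 𝔽 L k a)) := .ofFinite _
  let Z : Finset L := (LinearMap.ker (linearizedPoly 𝔽 L k a) : Set L).toFinset
  have hZ : Z.card ≤ p.natDegree := by
    refine Polynomial.card_le_degree_of_subset_roots fun x hx => ?_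
    have hx' : linearizedPoly 𝔽 L k a x = 0 := by simpa [Z] using hx
    rw [Polynomial.mem_roots hp0, Polynomial.IsRoot, ← hx', linearizedPoly_apply]
    simp [p, Polynomial.eval_finsetSum]
  have hcard : Z.card = Fintype.card 𝔽 ^ finrank 𝔽 (LinearMap.ker (linearizedPoly 𝔽 L k a)) := by
    rw [Set.toFinset_card, ← Module.card_eq_pow_finrank]
    rfl
  have h := (Nat.pow_le_pow_iff_right hq).1 (hcard ▸ hZ.trans hdeg)
  have := i₀.pos
  omega

/-- Every subspace of dimension `d` is the kernel of a linearized polynomial with `d + 1`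
coefficients. -/
lemma exists_ker_linearizedPoly_eq [FiniteDimensional 𝔽 L] (W : Submodule 𝔽 L) :
    ∃ a : Fin (finrank 𝔽 W + 1) → L, LinearMap.ker (linearizedPoly 𝔽 L _ a) = W := by
  let d := finrank 𝔽 W
  let ψ : (Fin (d + 1) → L) →ₗ[𝔽] W →ₗ[𝔽] L :=
    LinearMap.lcomp 𝔽 L W.subtype ∘ₗ linearizedPoly 𝔽 L (d + 1)
  have hlt : finrank 𝔽 (W →ₗ[𝔽] L) < finrank 𝔽 (Fin (d + 1) → L) := by
    rw [finrank_linearMap, finrank_pi_fintype, Finset.sum_const, Finset.card_univ,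
      Fintype.card_fin, smul_eq_mul]
    exact Nat.mul_lt_mul_of_pos_right (Nat.lt_succ_self d) finrank_pos
  obtain ⟨a, ha, ha0⟩ := Submodule.exists_mem_ne_zero_of_ne_bot
    (LinearMap.ker_ne_bot_of_finrank_lt (f := ψ) hlt)
  refine ⟨a, (Submodule.eq_of_le_of_finrank_le (fun x hx => ?_) ?_).symm⟩
  · exact LinearMap.congr_fun ha ⟨x, hx⟩
  · exact Nat.lt_succ_iff.1 (finrank_ker_linearizedPoly_lt ha0)

lemma linearizedPoly_castLE {j k : ℕ} (hjk : j ≤ k) (a : Fin j → L) :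
    ∃ b : Fin k → L, linearizedPoly 𝔽 L k b = linearizedPoly 𝔽 L j a := by
  obtain ⟨l, rfl⟩ := Nat.exists_eq_add_of_le hjk
  refine ⟨Fin.append a 0, LinearMap.ext fun x => ?_⟩
  simp [linearizedPoly_apply, Fin.sum_univ_add]

end Gabidulin

section LinearMaps

variable {K V W W' : Type*} [Field K] [AddCommGroup V] [Module K V] [AddCommGroup W] [Module K W]
  [AddCommGroup W'] [Module K W']

/-- Linear maps with equal kernels into spaces of equal dimension differ by an isomorphism. -/
lemma exists_linearEquiv_comp_eq_of_ker_eq [FiniteDimensional K W] [FiniteDimensional K W']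
    (hdim : finrank K W = finrank K W') {f : V →ₗ[K] W} {g : V →ₗ[K] W'}
    (h : LinearMap.ker f = LinearMap.ker g) : ∃ e : W ≃ₗ[K] W', e.toLinearMap ∘ₗ f = g := by
  let e₀ := LinearEquiv.ofFinrankEq W W' hdim
  let f' : V →ₗ[K] W' := e₀.toLinearMap ∘ₗ f
  have h' : LinearMap.ker f' = LinearMap.ker g := by
    rw [LinearMap.ker_comp_of_ker_eq_bot _ e₀.ker, h]
  let ε : LinearMap.range f' ≃ₗ[K] LinearMap.range g :=
    f'.quotKerEquivRange.symm ≪≫ₗ Submodule.quotEquivOfEq _ _ h' ≪≫ₗ g.quotKerEquivRange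
  obtain ⟨e₁, he₁⟩ := Submodule.exists_linearEquiv_restrict_eq ε
  refine ⟨e₀ ≪≫ₗ e₁, LinearMap.ext fun x => ?_⟩
  have hx := he₁ ⟨f' x, LinearMap.mem_range_self f' x⟩
  have hε : ε ⟨f' x, LinearMap.mem_range_self f' x⟩ = ⟨g x, LinearMap.mem_range_self g x⟩ := by
    have : f'.quotKerEquivRange.symm ⟨f' x, LinearMap.mem_range_self f' x⟩ =
        Submodule.Quotient.mk x :=
      f'.quotKerEquivRange_symm_apply_image x _
    simp only [ε, LinearEquiv.trans_apply, this]
    rfl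
  rw [hε] at hx
  exact hx.symm

end LinearMaps

section Anticodes

variable {𝔽 : Type*} [Field 𝔽] {n m : ℕ}

lemma rank_transpose_toMatrix' (f : (Fin n → 𝔽) →ₗ[𝔽] Fin m → 𝔽) :
    (LinearMap.toMatrix' f)ᵀ.rank = finrank 𝔽 (LinearMap.range f) := by
  rw [rank_transpose, Matrix.rank, ← Matrix.toLin'_apply', Matrix.toLin'_toMatrix']

variable [Fintype 𝔽]

/-- Every matrix of rank at least `n - k + 1` lies in a code of dimension `m * k` and minimum
distance at least `n - k + 1`. -/
lemma exists_mrd_code_mem (hnm : n ≤ m) {k : ℕ} (hk : k ≤ n) {M : Matrix (Fin n) (Fin m) 𝔽}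
    (hM : n < M.rank + k) :
    ∃ D : Submodule 𝔽 (Matrix (Fin n) (Fin m) 𝔽),
      M ∈ D ∧ finrank 𝔽 D = m * k ∧ ∀ N ∈ D, N ≠ 0 → n < N.rank + k := by
  obtain ⟨p, hp⟩ := CharP.exists 𝔽
  have : Fact p.Prime := ⟨CharP.char_is_prime 𝔽 p⟩
  have : NeZero m := ⟨by have := M.rank_le_height; omega⟩
  let L := FiniteField.Extension 𝔽 p m
  have hL : finrank 𝔽 L = m := FiniteField.finrank_extension 𝔽 p m
  obtain ⟨v, hv⟩ := exists_linearIndependent_of_le_finrank (hnm.trans hL.ge)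
  let u : (Fin n → 𝔽) →ₗ[𝔽] L := Fintype.linearCombination 𝔽 v
  have hu : Function.Injective u := hv.fintypeLinearCombination_injective
  let f : (Fin n → 𝔽) →ₗ[𝔽] Fin m → 𝔽 := Matrix.toLin' Mᵀ
  have hfM : (LinearMap.toMatrix' f)ᵀ = M := by
    rw [LinearMap.toMatrix'_toLin', transpose_transpose]
  let W : Submodule 𝔽 L := (LinearMap.ker f).map u
  have hW : finrank 𝔽 W + 1 ≤ k := by
    have h₁ := LinearMap.finrank_range_add_finrank_ker f
    rw [← rank_transpose_toMatrix', hfM, finrank_fin_fun] at h₁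
    have h₂ : finrank 𝔽 W ≤ finrank 𝔽 (LinearMap.ker f) := Submodule.finrank_map_le _ _
    omega
  obtain ⟨a, ha⟩ := exists_ker_linearizedPoly_eq W
  obtain ⟨b, hb⟩ := linearizedPoly_castLE (𝔽 := 𝔽) hW a
  have hker : LinearMap.ker (linearizedPoly 𝔽 L k b ∘ₗ u) = LinearMap.ker f := by
    rw [LinearMap.ker_comp, hb, ha, Submodule.comap_map_eq_of_injective hu]
  obtain ⟨e, he⟩ := exists_linearEquiv_comp_eq_of_ker_eq (hL.trans (finrank_fin_fun 𝔽).symm) hker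
  let Φ : (Fin k → L) →ₗ[𝔽] Matrix (Fin n) (Fin m) 𝔽 :=
    (Matrix.transposeLinearEquiv (Fin m) (Fin n) 𝔽 𝔽).toLinearMap ∘ₗ
      LinearMap.toMatrix'.toLinearMap ∘ₗ
      LinearMap.llcomp 𝔽 (Fin n → 𝔽) L (Fin m → 𝔽) e.toLinearMap ∘ₗ
      LinearMap.lcomp 𝔽 L u ∘ₗ linearizedPoly 𝔽 L k
  have hΦ (c : Fin k → L) :
      Φ c = (LinearMap.toMatrix' (e.toLinearMap ∘ₗ linearizedPoly 𝔽 L k c ∘ₗ u))ᵀ := rfl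
  have hrank {c : Fin k → L} (hc : c ≠ 0) : n < (Φ c).rank + k := by
    rw [hΦ, rank_transpose_toMatrix']
    have h₁ := LinearMap.finrank_range_add_finrank_ker
      (e.toLinearMap ∘ₗ linearizedPoly 𝔽 L k c ∘ₗ u)
    have h₂ : finrank 𝔽 (LinearMap.ker (e.toLinearMap ∘ₗ linearizedPoly 𝔽 L k c ∘ₗ u)) ≤
        finrank 𝔽 (LinearMap.ker (linearizedPoly 𝔽 L k c)) := by
      rw [LinearMap.ker_comp_of_ker_eq_bot _ e.ker, LinearMap.ker_comp,
        (Submodule.equivMapOfInjective u hu _).finrank_eq]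
      exact Submodule.finrank_mono (Submodule.map_comap_le _ _)
    have h₃ := finrank_ker_linearizedPoly_lt (𝔽 := 𝔽) hc
    rw [finrank_fin_fun] at h₁
    omega
  have hinj : Function.Injective Φ := by
    refine (injective_iff_map_eq_zero Φ).2 fun c hc => ?_
    by_contra hc0
    have h := hrank hc0
    rw [hc, rank_zero] at h
    omega
  refine ⟨LinearMap.range Φ, ⟨b, ?_⟩, ?_, ?_⟩
  · rw [hΦ, he, hfM]
  · rw [LinearMap.finrank_range_of_inj hinj, finrank_pi_fintype, Finset.sum_const,
      Finset.card_univ, Fintype.card_fin, smul_eq_mul, hL, mul_comm]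
  · rintro _ ⟨c, rfl⟩ hc
    exact hrank fun h => hc (h ▸ map_zero Φ)

lemma exists_rank_eq_height (𝔽 : Type*) [Field 𝔽] (hnm : n ≤ m) :
    ∃ M : Matrix (Fin n) (Fin m) 𝔽, M.rank = n := by
  obtain ⟨v, hv⟩ := exists_linearIndependent_of_le_finrank
    (hnm.trans (finrank_fin_fun (n := m) 𝔽).ge)
  refine ⟨Matrix.of v, ?_⟩
  rw [LinearIndependent.rank_matrix (M := Matrix.of v) hv, Fintype.card_fin]

/-- The anticode bound. -/
lemma finrank_le_mul_maxrk (hnm : n ≤ m)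
    (C : Submodule 𝔽 (Matrix (Fin n) (Fin m) 𝔽)) : finrank 𝔽 C ≤ m * maxrk C := by
  have htop : finrank 𝔽 (Matrix (Fin n) (Fin m) 𝔽) = m * n := by
    rw [finrank_matrix, Fintype.card_fin, Fintype.card_fin, finrank_self, mul_one, mul_comm]
  obtain hr | hr := (maxrk_le_height C).eq_or_lt
  · rw [hr, ← htop]
    exact Submodule.finrank_le C
  obtain ⟨M, hM⟩ := exists_rank_eq_height 𝔽 hnm
  obtain ⟨D, -, hdim, hD⟩ := exists_mrd_code_mem hnm (Nat.sub_le n (maxrk C))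
    (M := M) (by omega)
  have hdisj : Disjoint C D := by
    rw [Submodule.disjoint_def]
    intro N hNC hND
    by_contra hN0
    have h₁ := hD N hND hN0
    have h₂ := rank_le_maxrk hNC
    omega
  have h := Submodule.finrank_add_finrank_le_of_disjoint hdisj
  rw [hdim, htop, Nat.mul_sub] at h
  have := Nat.mul_le_mul_left m hr.le
  omega

/-- The dual of an optimal anticode of maximum rank `r` has maximum rank at most `n - r`. -/
lemma maxrk_dualCode_add_le (hnm : n ≤ m)
    {C : Submodule 𝔽 (Matrix (Fin n) (Fin m) 𝔽)} (hC : isOptAnticode C) :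
    maxrk (dualCode C) + maxrk C ≤ n := by
  have hr := maxrk_le_height C
  suffices maxrk (dualCode C) ≤ n - maxrk C by omega
  refine maxrk_le fun M hM => ?_
  by_contra! hlt
  obtain ⟨D, hMD, hdim, hD⟩ := exists_mrd_code_mem hnm hr (M := M) (by omega)
  have hM0 : M = 0 := by
    refine eq_zero_of_mem_dualCode (C := C) (D := dualCode D) ?_ ?_ hM ?_
    · have := finrank_add_finrank_dualCode D
      rwa [hdim, ← hC] at this
    · rw [Submodule.eq_bot_iff]
      rintro N ⟨hNC, hND⟩
      by_contra hN0
      exact (rank_le_maxrk hNC).not_gt (lt_rank_of_mem_dualCode hr hdim hD hND hN0)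
    · rwa [dualCode_dualCode]
  rw [hM0, rank_zero] at hlt
  omega

end Anticodes

lemma isQOAC_iff {𝔽 : Type*} [Field 𝔽] {n m : ℕ} (hm : 0 < m)
    (C : Submodule 𝔽 (Matrix (Fin n) (Fin m) 𝔽)) :
    isQOAC C ↔ m * maxrk C < finrank 𝔽 C + m ∧ finrank 𝔽 C < m * maxrk C := by
  have hm' : (0 : ℚ) < m := by exact_mod_cast hm
  rw [isQOAC, eq_comm (a := (maxrk C : ℤ)), Int.ceil_eq_iff, lt_div_iff₀ hm', div_le_iff₀ hm']
  have h₁ : (((maxrk C : ℤ) : ℚ) - 1) * m < finrank 𝔽 C ↔ m * maxrk C < finrank 𝔽 C + m := by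
    rw [← Nat.cast_lt (α := ℚ)]
    push_cast
    rw [← sub_lt_iff_lt_add]
    ring_nf
  have h₂ : (finrank 𝔽 C : ℚ) ≤ ((maxrk C : ℤ) : ℚ) * m ↔ finrank 𝔽 C ≤ m * maxrk C := by
    rw [← Nat.cast_le (α := ℚ)]
    push_cast
    rw [mul_comm]
  rw [h₁, h₂]
  constructor
  · rintro ⟨hd, hlt, hle⟩
    exact ⟨hlt, hle.lt_of_ne fun h => hd ⟨_, h⟩⟩
  · rintro ⟨hlt, hle⟩
    refine ⟨?_, hlt, hle.le⟩
    rintro ⟨d, hd⟩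
    rw [hd] at hlt hle
    rw [← Nat.mul_succ] at hlt
    have h₃ := Nat.lt_of_mul_lt_mul_left hlt
    have h₄ := Nat.lt_of_mul_lt_mul_left hle
    omega

/-- `C` is a dually qOAC iff `maxrk(C) + maxrk(C^⊥) = n + 1`. -/
theorem stmt2 {𝔽 : Type*} [Field 𝔽] [Fintype 𝔽] {n m : ℕ} (hn : 1 ≤ n) (hnm : n ≤ m)
    (C : Submodule 𝔽 (Matrix (Fin n) (Fin m) 𝔽)) :
    isDuallyQOAC C ↔ maxrk C + maxrk (dualCode C) = n + 1 := by
  have hm : 0 < m := hn.trans hnm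
  have hdim := finrank_add_finrank_dualCode C
  rw [isDuallyQOAC, isQOAC_iff hm, isQOAC_iff hm]
  constructor
  · rintro ⟨⟨h₁, h₂⟩, h₃, h₄⟩
    have hlo : m * n < m * (maxrk C + maxrk (dualCode C)) := by
      rw [mul_add]
      omega
    have hhi : m * (maxrk C + maxrk (dualCode C)) < m * (n + 2) := by
      rw [mul_add, mul_add]
      omega
    have h₅ := Nat.lt_of_mul_lt_mul_left hlo
    have h₆ := Nat.lt_of_mul_lt_mul_left hhi
    omega
  · intro h
    have hC := (finrank_le_mul_maxrk hnm C).lt_of_ne fun hC => by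
      have := maxrk_dualCode_add_le hnm hC
      omega
    have hD := (finrank_le_mul_maxrk hnm (dualCode C)).lt_of_ne fun hD => by
      have := maxrk_dualCode_add_le hnm hD
      rw [dualCode_dualCode] at this
      omega
    have hsum := congrArg (m * ·) h
    simp only [mul_add, mul_one] at hsum
    omega
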